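/- Let $T^2$ be a bi-tree with tensor-product weight $w = w_1 \otimes w_2 \geq 0$, and let $f : T^2 \to [0,\infty)$ be superadditive in each parameter separately with $\operatorname{supp} f \subseteq \{ \mathbb{I}(wf) \leq \delta \}$. Let $\lambda \geq 4\delta$. Then there exists $\varphi : T^2 \to [0,\infty)$ such that: (a) $\mathbb{I}(w\varphi)(\alpha) \geq \mathbb{I}(wf)(\alpha)$ for every $\alpha$ with $\mathbb{I}(wf)(\alpha) \in [\lambda, 2\lambda]$; and (b) $\sum_{T^2} w \varphi^2 \leq C\, \frac{\delta^2}{\lambda^2} \sum_{T^2} w f^2$ for an absolute constant $C$ (one may take $C = 64$). -/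

import Mathlib

open Finset
open scoped Classical

/-- A tree order: the set of elements above any given element is totally ordered. -/
def IsTreeOrder (T : Type*) [PartialOrder T] : Prop :=
  ∀ ω a b : T, ω ≤ a → ω ≤ b → a ≤ b ∨ b ≤ a

/-- The Hardy operator `I f α = ∑_{α' ≥ α} f α'`. -/
noncomputable def hI {T : Type*} [Fintype T] [PartialOrder T] (f : T → ℝ) (a : T) : ℝ :=
  ∑ b, if a ≤ b then f b else 0

/-- The adjoint Hardy operator `I* f β = ∑_{α ≤ β} f α`. -/
noncomputable def hIstar {T : Type*} [Fintype T] [PartialOrder T] (f : T → ℝ) (b : T) : ℝ :=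
  ∑ a, if a ≤ b then f a else 0

/-- `b` is a child of `β`: a maximal element of the set of elements strictly below `β`. -/
def IsChild {T : Type*} [PartialOrder T] (b β : T) : Prop :=
  b < β ∧ ∀ c, b < c → c < β → False

/-- The difference operator `Δ f β = f β - ∑_{β' ∈ ch β} f β'`. -/
noncomputable def hDelta {T : Type*} [Fintype T] [PartialOrder T] (f : T → ℝ) (β : T) : ℝ :=
  f β - ∑ b, if IsChild b β then f b else 0

/-- A superadditive function on a tree: `f β ≥ ∑_{β' ∈ ch β} f β'` for all `β`. -/
def Superadd {T : Type*} [Fintype T] [PartialOrder T] (f : T → ℝ) : Prop :=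
  ∀ β : T, (∑ b, if IsChild b β then f b else 0) ≤ f β

/-- The Hardy operator acting in the first coordinate of a bi-tree. -/
noncomputable def hI1 {T1 T2 : Type*} [Fintype T1] [PartialOrder T1]
    (f : T1 × T2 → ℝ) (a : T1 × T2) : ℝ :=
  ∑ b : T1, if a.1 ≤ b then f (b, a.2) else 0

/-- The Hardy operator acting in the second coordinate of a bi-tree. -/
noncomputable def hI2 {T1 T2 : Type*} [Fintype T2] [PartialOrder T2]
    (f : T1 × T2 → ℝ) (a : T1 × T2) : ℝ :=
  ∑ b : T2, if a.2 ≤ b then f (a.1, b) else 0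

/-- Superadditivity in the first parameter separately. -/
def Superadd1 {T1 T2 : Type*} [Fintype T1] [PartialOrder T1]
    (f : T1 × T2 → ℝ) : Prop :=
  ∀ (β : T1) (a2 : T2), (∑ b, if IsChild b β then f (b, a2) else 0) ≤ f (β, a2)

/-- Superadditivity in the second parameter separately. -/
def Superadd2 {T1 T2 : Type*} [Fintype T2] [PartialOrder T2]
    (f : T1 × T2 → ℝ) : Prop :=
  ∀ (a1 : T1) (β : T2), (∑ b, if IsChild b β then f (a1, b) else 0) ≤ f (a1, β)

/-- On a tree, a function is the adjoint Hardy operator applied to its difference. -/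
theorem hIstar_hDelta {T : Type*} [Fintype T] [PartialOrder T] (hT : IsTreeOrder T)
    (g : T → ℝ) (β : T) : hIstar (hDelta g) β = g β := by
  induction β using WellFoundedLT.induction with
  | ind β ih =>
    have key : ∀ a, (if a ≤ β then hDelta g a else 0) = (if a = β then hDelta g a else 0) +
        ∑ c, if IsChild c β then (if a ≤ c then hDelta g a else 0) else 0 := by
      intro a
      by_cases hab : a ≤ β
      · rcases eq_or_lt_of_le hab with rfl | hlt
        · rw [Finset.sum_eq_zero]
          · simp
          · intro c _
            split_ifs with hc hac
            · exact absurd hac (not_le_of_gt hc.1)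
            · rfl
            · rfl
        · obtain ⟨c, hc, hmax⟩ := Finset.exists_le_maximal
            (Finset.univ.filter fun c : T => a ≤ c ∧ c < β) (a := a) (by simp [hlt])
          have hc' : a ≤ c ∧ c < β := by simpa using hmax.prop
          have hchild : IsChild c β := by
            refine ⟨hc'.2, fun d hcd hdβ => ?_⟩
            exact not_le_of_gt hcd
              (hmax.le_of_ge (by simpa using ⟨hc'.1.trans hcd.le, hdβ⟩) hcd.le)
          rw [Finset.sum_eq_single c]
          · simp [hlt.ne, hab, hchild, hc'.1]
          · intro d _ hdc
            split_ifs with hd had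
            · exfalso
              rcases hT a c d hc'.1 had with h | h
              · exact hchild.2 d (lt_of_le_of_ne h (Ne.symm hdc)) hd.1
              · exact hd.2 c (lt_of_le_of_ne h hdc) hc'.2
            · rfl
            · rfl
          · simp
      · rw [Finset.sum_eq_zero]
        · have : a ≠ β := fun h => hab h.le
          simp [hab, this]
        · intro c _
          split_ifs with hc hac
          · exact absurd (hac.trans hc.1.le) hab
          · rfl
          · rfl
    unfold hIstar
    rw [Finset.sum_congr rfl fun a _ => key a, Finset.sum_add_distrib, Finset.sum_comm]
    have h : ∀ c, (∑ a, if IsChild c β then (if a ≤ c then hDelta g a else 0) else 0) =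
        if IsChild c β then g c else 0 := by
      intro c
      split_ifs with hc
      · exact ih c hc.1
      · simp
    rw [Finset.sum_congr rfl fun c _ => h c]
    simp [hDelta]

/-- A superadditive function `g` pairs with `h` below `d` to at most `δ * g d` as soon as
`hI h ≤ δ` on the support of `g`. -/
theorem hIstar_mul_le {T : Type*} [Fintype T] [PartialOrder T] (hT : IsTreeOrder T)
    {g h : T → ℝ} (hg : ∀ a, 0 ≤ g a) (hgs : Superadd g) (hh : ∀ a, 0 ≤ h a) {δ : ℝ}
    (hδ : ∀ a, g a ≠ 0 → hI h a ≤ δ) (d : T) :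
    hIstar (fun b => g b * h b) d ≤ δ * g d := by
  have hμ : ∀ a, 0 ≤ hDelta g a := fun a => sub_nonneg.2 (hgs a)
  have hμg : ∀ a, hDelta g a ≤ g a := fun a => sub_le_self _
    (Finset.sum_nonneg fun b _ => by split_ifs <;> simp [hg])
  calc hIstar (fun b => g b * h b) d
      = ∑ b, ∑ a, if b ≤ d then (if a ≤ b then hDelta g a else 0) * h b else 0 := by
        refine Finset.sum_congr rfl fun b _ => ?_
        split_ifs
        · rw [← Finset.sum_mul]
          exact congrArg (· * h b) (hIstar_hDelta hT g b).symm
        · simp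
    _ = ∑ a, ∑ b, if b ≤ d then (if a ≤ b then hDelta g a else 0) * h b else 0 :=
        Finset.sum_comm
    _ ≤ ∑ a, if a ≤ d then δ * hDelta g a else 0 := by
        refine Finset.sum_le_sum fun a _ => ?_
        by_cases had : a ≤ d
        · rw [if_pos had]
          calc (∑ b, if b ≤ d then (if a ≤ b then hDelta g a else 0) * h b else 0)
              ≤ ∑ b, hDelta g a * (if a ≤ b then h b else 0) := by
                refine Finset.sum_le_sum fun b _ => ?_
                have := mul_nonneg (hμ a) (hh b)
                split_ifs <;> simp [this]
            _ = hDelta g a * hI h a := by rw [hI, Finset.mul_sum]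
            _ ≤ δ * hDelta g a := by
                rw [mul_comm]
                by_cases h0 : hDelta g a = 0
                · simp [h0]
                · have hga : g a ≠ 0 := fun hz => h0 (le_antisymm (hz ▸ hμg a) (hμ a))
                  exact mul_le_mul_of_nonneg_right (hδ a hga) (hμ a)
        · rw [if_neg had]
          refine Finset.sum_nonpos fun b _ => ?_
          split_ifs with hb hab
          · exact absurd (hab.trans hb) had
          · simp
          · rfl
    _ = δ * g d := by
        rw [← hIstar_hDelta hT g d, hIstar, Finset.mul_sum]
        exact Finset.sum_congr rfl fun a _ => by split_ifs <;> simp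

/-- The square of a Hardy sum on a tree is at most twice its ordered part. -/
theorem hI_sq_le {T : Type*} [Fintype T] [PartialOrder T] (hT : IsTreeOrder T)
    {u : T → ℝ} (hu : ∀ a, 0 ≤ u a) (b : T) :
    hI u b ^ 2 ≤ 2 * hI (fun d => u d * hI u d) b := by
  have hle : ∀ d c, (if b ≤ d then u d else 0) * (if b ≤ c then u c else 0) ≤
      (if b ≤ d then u d * (if d ≤ c then u c else 0) else 0) +
      (if b ≤ c then u c * (if c ≤ d then u d else 0) else 0) := by
    intro d c
    have h := mul_nonneg (hu d) (hu c)
    have h' := mul_nonneg (hu c) (hu d)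
    by_cases hd : b ≤ d <;> by_cases hc : b ≤ c
    · rcases hT b d c hd hc with hdc | hcd
      · simp only [hd, hc, hdc, if_true]
        split_ifs <;> simp [h']
      · simp only [hd, hc, hcd, if_true]
        split_ifs <;> linarith
    · simp only [hd, hc, if_true, if_false]
      split_ifs <;> simp [h]
    · simp only [hd, hc, if_true, if_false]
      split_ifs <;> simp [h']
    · simp [hd, hc]
  have hexp : hI (fun d => u d * hI u d) b =
      ∑ d, ∑ c, if b ≤ d then u d * (if d ≤ c then u c else 0) else 0 := by
    refine Finset.sum_congr rfl fun d _ => ?_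
    split_ifs
    · simp only [hI, Finset.mul_sum]
    · simp
  have hexp' : hI (fun d => u d * hI u d) b =
      ∑ d, ∑ c, if b ≤ c then u c * (if c ≤ d then u d else 0) else 0 := by
    rw [hexp, Finset.sum_comm]
  rw [two_mul]
  nth_rewrite 1 [hexp]
  rw [hexp', sq, hI, Finset.sum_mul_sum, ← Finset.sum_add_distrib]
  refine Finset.sum_le_sum fun d _ => ?_
  rw [← Finset.sum_add_distrib]
  exact Finset.sum_le_sum fun c _ => hle d c

/-- The Hardy operator on a product is the composition of the coordinate ones. -/
theorem hI_prod {T1 T2 : Type*} [Fintype T1] [PartialOrder T1] [Fintype T2] [PartialOrder T2]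
    (F : T1 × T2 → ℝ) (a : T1 × T2) :
    hI F a = hI (fun b1 => hI (fun b2 => F (b1, b2)) a.2) a.1 := by
  simp only [hI, Fintype.sum_prod_type]
  refine Finset.sum_congr rfl fun b1 _ => ?_
  by_cases h : a.1 ≤ b1 <;> simp [Prod.le_def, h]

theorem hI_comm {T1 T2 : Type*} [Fintype T1] [PartialOrder T1] [Fintype T2] [PartialOrder T2]
    (F : T1 → T2 → ℝ) (a1 : T1) (a2 : T2) :
    hI (fun b1 => hI (F b1) a2) a1 = hI (fun b2 => hI (fun b1 => F b1 b2) a1) a2 := by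
  simp only [hI, ← Finset.sum_filter]
  exact Finset.sum_comm

theorem hI_nonneg {T : Type*} [Fintype T] [PartialOrder T] {u : T → ℝ} (hu : ∀ a, 0 ≤ u a)
    (a : T) : 0 ≤ hI u a :=
  Finset.sum_nonneg fun b _ => by split_ifs <;> simp [hu]

theorem hI_const_mul {T : Type*} [Fintype T] [PartialOrder T] (c : ℝ) (u : T → ℝ) (a : T) :
    hI (fun x => c * u x) a = c * hI u a := by
  simp only [hI, Finset.mul_sum, mul_ite, mul_zero]

theorem hI_mono {T : Type*} [Fintype T] [PartialOrder T] {u v : T → ℝ} (h : ∀ a, u a ≤ v a)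
    (a : T) : hI u a ≤ hI v a :=
  Finset.sum_le_sum fun b _ => by split_ifs <;> simp [h]

/-- On a bi-tree, the square of a Hardy sum is controlled by its diagonal and antidiagonal
parts. -/
theorem hI_prod_sq_le {T1 T2 : Type*} [Fintype T1] [PartialOrder T1] [Fintype T2]
    [PartialOrder T2] (h1 : IsTreeOrder T1) (h2 : IsTreeOrder T2) {F : T1 × T2 → ℝ}
    (hF : ∀ x, 0 ≤ F x) (α : T1 × T2) :
    hI F α ^ 2 ≤ 2 * hI (fun x => F x * hI F x) α + 2 * hI (fun x => hI1 F x * hI2 F x) α := by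
  have hM : hI (fun x => hI1 F x * hI2 F x) α = ∑ b1, ∑ b2, ∑ c1, ∑ c2,
      if α.1 ≤ b1 ∧ α.2 ≤ b2 ∧ b1 ≤ c1 ∧ b2 ≤ c2 then F (c1, b2) * F (b1, c2) else 0 := by
    simp only [hI, Fintype.sum_prod_type, hI1, hI2, Finset.sum_mul_sum]
    refine Finset.sum_congr rfl fun b1 _ => Finset.sum_congr rfl fun b2 _ => ?_
    by_cases hb : α ≤ (b1, b2)
    · rw [if_pos hb]
      refine Finset.sum_congr rfl fun c1 _ => Finset.sum_congr rfl fun c2 _ => ?_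
      have hb' : α.1 ≤ b1 ∧ α.2 ≤ b2 := hb
      by_cases p : b1 ≤ c1 <;> by_cases q : b2 ≤ c2 <;> simp [hb', p, q]
    · rw [if_neg hb]
      have hb' : ¬ (α.1 ≤ b1 ∧ α.2 ≤ b2) := hb
      symm
      refine Finset.sum_eq_zero fun c1 _ => Finset.sum_eq_zero fun c2 _ => if_neg ?_
      tauto
  have hM1 : hI (fun x => hI1 F x * hI2 F x) α = ∑ p, ∑ q, ∑ r, ∑ s,
      if α.1 ≤ r ∧ α.2 ≤ q ∧ r ≤ p ∧ q ≤ s then F (p, q) * F (r, s) else 0 := by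
    rw [hM]
    calc _ = ∑ b1, ∑ c1, ∑ b2, ∑ c2, (if α.1 ≤ b1 ∧ α.2 ≤ b2 ∧ b1 ≤ c1 ∧ b2 ≤ c2
              then F (c1, b2) * F (b1, c2) else 0) :=
          Finset.sum_congr rfl fun b1 _ => Finset.sum_comm
      _ = _ := by
          rw [Finset.sum_comm]
          exact Finset.sum_congr rfl fun c1 _ => Finset.sum_comm
  have hM2 : hI (fun x => hI1 F x * hI2 F x) α = ∑ p, ∑ q, ∑ r, ∑ s,
      if α.1 ≤ p ∧ α.2 ≤ s ∧ p ≤ r ∧ s ≤ q then F (p, q) * F (r, s) else 0 := by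
    rw [hM]
    refine Finset.sum_congr rfl fun b1 _ => ?_
    calc _ = ∑ b2, ∑ c2, ∑ c1, (if α.1 ≤ b1 ∧ α.2 ≤ b2 ∧ b1 ≤ c1 ∧ b2 ≤ c2
              then F (c1, b2) * F (b1, c2) else 0) :=
          Finset.sum_congr rfl fun b2 _ => Finset.sum_comm
      _ = _ := by
          rw [Finset.sum_comm]
          refine Finset.sum_congr rfl fun c2 _ => ?_
          rw [Finset.sum_comm]
          exact Finset.sum_congr rfl fun c1 _ => Finset.sum_congr rfl fun b2 _ => by
            rw [mul_comm]
  have hD1 : hI (fun x => F x * hI F x) α = ∑ p, ∑ q, ∑ r, ∑ s,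
      if α.1 ≤ p ∧ α.2 ≤ q ∧ p ≤ r ∧ q ≤ s then F (p, q) * F (r, s) else 0 := by
    simp only [hI, Fintype.sum_prod_type]
    refine Finset.sum_congr rfl fun p _ => Finset.sum_congr rfl fun q _ => ?_
    by_cases hb : α ≤ (p, q)
    · rw [if_pos hb]
      have hb' : α.1 ≤ p ∧ α.2 ≤ q := hb
      simp only [Finset.mul_sum]
      refine Finset.sum_congr rfl fun r _ => Finset.sum_congr rfl fun s _ => ?_
      by_cases h : p ≤ r <;> by_cases h' : q ≤ s <;> simp [hb', h, h']
    · rw [if_neg hb]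
      have hb' : ¬ (α.1 ≤ p ∧ α.2 ≤ q) := hb
      symm
      refine Finset.sum_eq_zero fun c1 _ => Finset.sum_eq_zero fun c2 _ => if_neg ?_
      tauto
  have hD2 : hI (fun x => F x * hI F x) α = ∑ p, ∑ q, ∑ r, ∑ s,
      if α.1 ≤ r ∧ α.2 ≤ s ∧ r ≤ p ∧ s ≤ q then F (p, q) * F (r, s) else 0 := by
    rw [hD1]
    have := Finset.sum_comm (s := (Finset.univ : Finset (T1 × T2)))
      (t := (Finset.univ : Finset (T1 × T2))) (f := fun x y =>
        if α.1 ≤ x.1 ∧ α.2 ≤ x.2 ∧ x.1 ≤ y.1 ∧ x.2 ≤ y.2 then F x * F y else 0)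
    simp only [Fintype.sum_prod_type] at this
    rw [this]
    refine Finset.sum_congr rfl fun p _ => Finset.sum_congr rfl fun q _ =>
      Finset.sum_congr rfl fun r _ => Finset.sum_congr rfl fun s _ => ?_
    rw [mul_comm]
  have hS : hI F α ^ 2 = ∑ p, ∑ q, ∑ r, ∑ s,
      if (α.1 ≤ p ∧ α.2 ≤ q) ∧ α.1 ≤ r ∧ α.2 ≤ s then F (p, q) * F (r, s) else 0 := by
    rw [sq]
    simp only [hI, Finset.sum_mul_sum]
    simp only [Fintype.sum_prod_type]
    refine Finset.sum_congr rfl fun p _ => Finset.sum_congr rfl fun q _ =>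
      Finset.sum_congr rfl fun r _ => Finset.sum_congr rfl fun s _ => ?_
    simp only [Prod.le_def, ite_and, mul_ite, ite_mul, zero_mul, mul_zero]
    split_ifs <;> rfl
  rw [two_mul, two_mul]
  nth_rewrite 1 [hD1]
  nth_rewrite 1 [hM1]
  rw [hD2, hM2, hS]
  simp only [← Finset.sum_add_distrib]
  refine Finset.sum_le_sum fun p _ => Finset.sum_le_sum fun q _ =>
    Finset.sum_le_sum fun r _ => Finset.sum_le_sum fun s _ => ?_
  have h0 := mul_nonneg (hF (p, q)) (hF (r, s))
  have hite : ∀ (P : Prop) [Decidable P], 0 ≤ if P then F (p, q) * F (r, s) else 0 := fun P _ => by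
    split_ifs <;> simp [h0]
  have i1 := hite (α.1 ≤ p ∧ α.2 ≤ q ∧ p ≤ r ∧ q ≤ s)
  have i2 := hite (α.1 ≤ r ∧ α.2 ≤ s ∧ r ≤ p ∧ s ≤ q)
  have i3 := hite (α.1 ≤ r ∧ α.2 ≤ q ∧ r ≤ p ∧ q ≤ s)
  have i4 := hite (α.1 ≤ p ∧ α.2 ≤ s ∧ p ≤ r ∧ s ≤ q)
  by_cases hc : (α.1 ≤ p ∧ α.2 ≤ q) ∧ α.1 ≤ r ∧ α.2 ≤ s
  · rw [if_pos hc]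
    obtain ⟨⟨ap, aq⟩, ar, as⟩ := hc
    rcases h1 _ p r ap ar with hpr | hpr <;> rcases h2 _ q s aq as with hqs | hqs
    · rw [if_pos ⟨ap, aq, hpr, hqs⟩]; linarith
    · rw [if_pos (⟨ap, as, hpr, hqs⟩ : α.1 ≤ p ∧ α.2 ≤ s ∧ p ≤ r ∧ s ≤ q)]; linarith
    · rw [if_pos (⟨ar, aq, hpr, hqs⟩ : α.1 ≤ r ∧ α.2 ≤ q ∧ r ≤ p ∧ q ≤ s)]; linarith
    · rw [if_pos (⟨ar, as, hpr, hqs⟩ : α.1 ≤ r ∧ α.2 ≤ s ∧ r ≤ p ∧ s ≤ q)]; linarith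
  · rw [if_neg hc]; linarith

/-- Pairing coordinate Hardy sums is adjoint to pairing coordinate adjoint Hardy sums. -/
theorem sum_hI_mul_hI {T1 T2 : Type*} [Fintype T1] [PartialOrder T1] [Fintype T2]
    [PartialOrder T2] (v1 : T1 → ℝ) (v2 : T2 → ℝ) (X Y : T1 → T2 → ℝ) :
    ∑ b1, ∑ b2, v1 b1 * v2 b2 * (hI (fun d1 => X d1 b2) b1 * hI (Y b1) b2) =
      ∑ d1, ∑ d2, hIstar (fun b2 => v2 b2 * X d1 b2) d2 *
        hIstar (fun b1 => v1 b1 * Y b1 d2) d1 := by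
  have hL : ∀ b1 b2, v1 b1 * v2 b2 * (hI (fun d1 => X d1 b2) b1 * hI (Y b1) b2) =
      ∑ d1, ∑ d2, (if b2 ≤ d2 then v2 b2 * X d1 b2 else 0) *
        (if b1 ≤ d1 then v1 b1 * Y b1 d2 else 0) := by
    intro b1 b2
    rw [hI, hI, Finset.sum_mul_sum]
    simp only [Finset.mul_sum]
    refine Finset.sum_congr rfl fun d1 _ => Finset.sum_congr rfl fun d2 _ => ?_
    split_ifs <;> ring
  simp only [hL, hIstar, Finset.sum_mul_sum]
  calc _ = ∑ b1, ∑ d1, ∑ b2, ∑ d2, (if b2 ≤ d2 then v2 b2 * X d1 b2 else 0) *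
        (if b1 ≤ d1 then v1 b1 * Y b1 d2 else 0) :=
        Finset.sum_congr rfl fun b1 _ => Finset.sum_comm
    _ = ∑ d1, ∑ b1, ∑ d2, ∑ b2, (if b2 ≤ d2 then v2 b2 * X d1 b2 else 0) *
        (if b1 ≤ d1 then v1 b1 * Y b1 d2 else 0) := by
        rw [Finset.sum_comm]
        exact Finset.sum_congr rfl fun d1 _ => Finset.sum_congr rfl fun b1 _ => Finset.sum_comm
    _ = _ := by
        refine Finset.sum_congr rfl fun d1 _ => ?_
        rw [Finset.sum_comm]
        exact Finset.sum_congr rfl fun d2 _ => Finset.sum_comm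

theorem stmt14 {T1 T2 : Type*} [Fintype T1] [PartialOrder T1] [Fintype T2] [PartialOrder T2]
    (h1 : IsTreeOrder T1) (h2 : IsTreeOrder T2)
    (w1 : T1 → ℝ) (w2 : T2 → ℝ) (hw1 : ∀ x, 0 ≤ w1 x) (hw2 : ∀ x, 0 ≤ w2 x)
    (f : T1 × T2 → ℝ) (hf : ∀ a, 0 ≤ f a)
    (hs1 : Superadd1 f) (hs2 : Superadd2 f) (δ lam : ℝ) (hδ : 0 < δ)
    (hlam : 4 * δ ≤ lam)
    (hsupp : ∀ a, f a ≠ 0 → hI (fun x => w1 x.1 * w2 x.2 * f x) a ≤ δ) :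
    ∃ φ : T1 × T2 → ℝ, (∀ a, 0 ≤ φ a) ∧
      (∀ α, lam ≤ hI (fun x => w1 x.1 * w2 x.2 * f x) α →
        hI (fun x => w1 x.1 * w2 x.2 * f x) α ≤ 2 * lam →
        hI (fun x => w1 x.1 * w2 x.2 * f x) α ≤ hI (fun x => w1 x.1 * w2 x.2 * φ x) α) ∧
      ∑ a, w1 a.1 * w2 a.2 * φ a ^ 2 ≤
        64 * (δ ^ 2 / lam ^ 2) * ∑ a, w1 a.1 * w2 a.2 * f a ^ 2 := by
  have hlam0 : 0 < lam := by linarith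
  set F : T1 × T2 → ℝ := fun x => w1 x.1 * w2 x.2 * f x with hFdef
  have hF : ∀ x, 0 ≤ F x := fun x => mul_nonneg (mul_nonneg (hw1 _) (hw2 _)) (hf x)
  let P : T1 → T2 → ℝ := fun b1 b2 => hI (fun c => w1 c * f (c, b2)) b1
  let Q : T1 → T2 → ℝ := fun b1 b2 => hI (fun c => w2 c * f (b1, c)) b2
  have hP : ∀ b1 b2, 0 ≤ P b1 b2 := fun b1 b2 =>
    hI_nonneg (fun c => mul_nonneg (hw1 _) (hf _)) _
  have hQ : ∀ b1 b2, 0 ≤ Q b1 b2 := fun b1 b2 =>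
    hI_nonneg (fun c => mul_nonneg (hw2 _) (hf _)) _
  have hF1 : ∀ x, hI1 F x = w2 x.2 * P x.1 x.2 := fun x => by
    rw [← hI_const_mul]
    exact Finset.sum_congr rfl fun c _ => by split_ifs <;> simp only [hFdef]; ring
  have hF2 : ∀ x, hI2 F x = w1 x.1 * Q x.1 x.2 := fun x => by
    rw [← hI_const_mul]
    exact Finset.sum_congr rfl fun c _ => by split_ifs <;> simp only [hFdef]; ring
  refine ⟨fun x => 4 / lam * (P x.1 x.2 * Q x.1 x.2), fun a =>
    mul_nonneg (by positivity) (mul_nonneg (hP _ _) (hQ _ _)), fun α hα _ => ?_, ?_⟩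
  · have hsq := hI_prod_sq_le h1 h2 hF α
    have hdiag : hI (fun x => F x * hI F x) α ≤ δ * hI F α := by
      rw [← hI_const_mul]
      refine hI_mono (fun x => ?_) α
      by_cases h0 : f x = 0
      · simp [hFdef, h0]
      · rw [mul_comm]
        exact mul_le_mul_of_nonneg_right (hsupp x h0) (hF x)
    have hφ : (fun x : T1 × T2 => w1 x.1 * w2 x.2 * (4 / lam * (P x.1 x.2 * Q x.1 x.2))) =
        fun x => 4 / lam * (hI1 F x * hI2 F x) := by
      funext x
      rw [hF1, hF2]
      ring
    rw [hφ, hI_const_mul, div_mul_eq_mul_div, le_div_iff₀ hlam0]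
    nlinarith [mul_nonneg (hI_nonneg hF α) (sub_nonneg.2 hα),
      mul_nonneg (hI_nonneg hF α) (sub_nonneg.2 hlam)]
  · let X : T1 → T2 → ℝ := fun d1 b2 => w1 d1 * f (d1, b2) * P d1 b2
    let Y : T1 → T2 → ℝ := fun b1 d2 => w2 d2 * f (b1, d2) * Q b1 d2
    have hP2 : ∀ b1 b2, P b1 b2 ^ 2 ≤ 2 * hI (fun d1 => X d1 b2) b1 := fun b1 b2 =>
      hI_sq_le h1 (fun c => mul_nonneg (hw1 _) (hf _)) b1
    have hQ2 : ∀ b1 b2, Q b1 b2 ^ 2 ≤ 2 * hI (Y b1) b2 := fun b1 b2 =>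
      hI_sq_le h2 (fun c => mul_nonneg (hw2 _) (hf _)) b2
    have hX : ∀ d1 d2, hIstar (fun b2 => w2 b2 * X d1 b2) d2 ≤ w1 d1 * (δ * f (d1, d2)) := by
      intro d1 d2
      have h := hIstar_mul_le h2 (g := fun b2 => f (d1, b2)) (h := fun b2 => w2 b2 * P d1 b2)
        (fun _ => hf _) (fun β => hs2 d1 β) (fun _ => mul_nonneg (hw2 _) (hP _ _)) (δ := δ)
        (fun a ha => by
          have := hsupp (d1, a) ha
          rw [hI_prod, hI_comm (fun b1 b2 => F (b1, b2))] at this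
          convert this using 3 with b2
          exact (hF1 (d1, b2)).symm) d2
      refine le_trans (le_of_eq ?_) (mul_le_mul_of_nonneg_left h (hw1 d1))
      simp only [hIstar, Finset.mul_sum]
      exact Finset.sum_congr rfl fun b _ => by
        split_ifs <;> (try simp only [X]) <;> ring
    have hY : ∀ d1 d2, hIstar (fun b1 => w1 b1 * Y b1 d2) d1 ≤ w2 d2 * (δ * f (d1, d2)) := by
      intro d1 d2
      have h := hIstar_mul_le h1 (g := fun b1 => f (b1, d2)) (h := fun b1 => w1 b1 * Q b1 d2)
        (fun _ => hf _) (fun β => hs1 β d2) (fun _ => mul_nonneg (hw1 _) (hQ _ _)) (δ := δ)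
        (fun a ha => by
          have := hsupp (a, d2) ha
          rw [hI_prod] at this
          convert this using 3 with b1
          exact (hF2 (b1, d2)).symm) d1
      refine le_trans (le_of_eq ?_) (mul_le_mul_of_nonneg_left h (hw2 d2))
      simp only [hIstar, Finset.mul_sum]
      exact Finset.sum_congr rfl fun b _ => by
        split_ifs <;> (try simp only [Y]) <;> ring
    have hY0 : ∀ d1 d2, 0 ≤ hIstar (fun b1 => w1 b1 * Y b1 d2) d1 := fun d1 d2 =>
      Finset.sum_nonneg fun b _ => by
        have := mul_nonneg (hw1 b) (mul_nonneg (mul_nonneg (hw2 d2) (hf (b, d2))) (hQ b d2))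
        split_ifs
        · exact this
        · rfl
    have hmain : ∑ b1, ∑ b2, w1 b1 * w2 b2 * (P b1 b2 ^ 2 * Q b1 b2 ^ 2) ≤
        4 * (δ ^ 2 * ∑ d1, ∑ d2, w1 d1 * w2 d2 * f (d1, d2) ^ 2) := by
      calc ∑ b1, ∑ b2, w1 b1 * w2 b2 * (P b1 b2 ^ 2 * Q b1 b2 ^ 2)
          ≤ ∑ b1, ∑ b2, 4 * (w1 b1 * w2 b2 * (hI (fun d1 => X d1 b2) b1 * hI (Y b1) b2)) := by
            refine Finset.sum_le_sum fun b1 _ => Finset.sum_le_sum fun b2 _ => ?_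
            have h := mul_le_mul_of_nonneg_left
              (mul_le_mul (hP2 b1 b2) (hQ2 b1 b2) (sq_nonneg _) ((sq_nonneg _).trans (hP2 b1 b2)))
              (mul_nonneg (hw1 b1) (hw2 b2))
            linarith
        _ = 4 * ∑ d1, ∑ d2, hIstar (fun b2 => w2 b2 * X d1 b2) d2 *
              hIstar (fun b1 => w1 b1 * Y b1 d2) d1 := by
            rw [← sum_hI_mul_hI]
            simp only [Finset.mul_sum]
        _ ≤ 4 * (δ ^ 2 * ∑ d1, ∑ d2, w1 d1 * w2 d2 * f (d1, d2) ^ 2) := by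
            refine mul_le_mul_of_nonneg_left ?_ (by norm_num)
            simp only [Finset.mul_sum]
            refine Finset.sum_le_sum fun d1 _ => Finset.sum_le_sum fun d2 _ => ?_
            refine (mul_le_mul (hX d1 d2) (hY d1 d2) (hY0 d1 d2)
              (mul_nonneg (hw1 d1) (mul_nonneg hδ.le (hf _)))).trans (le_of_eq ?_)
            ring
    calc ∑ a : T1 × T2, w1 a.1 * w2 a.2 * (4 / lam * (P a.1 a.2 * Q a.1 a.2)) ^ 2
        = 16 / lam ^ 2 * ∑ b1, ∑ b2, w1 b1 * w2 b2 * (P b1 b2 ^ 2 * Q b1 b2 ^ 2) := by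
          simp only [Fintype.sum_prod_type, Finset.mul_sum]
          refine Finset.sum_congr rfl fun b1 _ => Finset.sum_congr rfl fun b2 _ => ?_
          ring
      _ ≤ 16 / lam ^ 2 * (4 * (δ ^ 2 * ∑ d1, ∑ d2, w1 d1 * w2 d2 * f (d1, d2) ^ 2)) :=
          mul_le_mul_of_nonneg_left hmain (by positivity)
      _ = 64 * (δ ^ 2 / lam ^ 2) * ∑ a : T1 × T2, w1 a.1 * w2 a.2 * f a ^ 2 := by
          rw [Fintype.sum_prod_type]
          ring
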